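/- arXiv:2511.05788 — 2 statements merged into one kernel-verified Lean document; each statement's English description precedes it below -/
import Mathlib

section
/- Consider the HAR-S method with budget B satisfying B ≥ Ū + 1. Suppose in addition that f is convex and that the initial sublevel set {x ∈ dom ψ : F(x) ≤ F(x^0)} has diameter at most R < ∞. Then for every integer k with k(1 − Ū/B) − Ū > 0, F(x^k) − F(x⋆) ≤ (2 α H_max R^{p+1} / p!) · ((p+1)/(k(1 − Ū/B) − Ū))^p, where H_max = max{H_0, L_p} and Ū = ⌈log_{(α+1)/2}(H_max/H_0)⌉. -/
open scoped BigOperators RealInnerProductSpace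

noncomputable section

/-- The `p`-th order Taylor polynomial `T_p(y; x)` of `f` at `x`, evaluated at `y`. -/
def taylorPoly {n : ℕ} (p : ℕ) (f : EuclideanSpace ℝ (Fin n) → ℝ)
    (x y : EuclideanSpace ℝ (Fin n)) : ℝ :=
  f x + ∑ ℓ ∈ Finset.Icc 1 p,
    (1 / (Nat.factorial ℓ : ℝ)) * iteratedFDeriv ℝ ℓ f x (fun _ => y - x)

/-- The regularized Taylor polynomial `Ω_p^σ(y; x)`. -/
def omegaReg {n : ℕ} (p : ℕ) (σ : ℝ) (f : EuclideanSpace ℝ (Fin n) → ℝ)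
    (x y : EuclideanSpace ℝ (Fin n)) : ℝ :=
  taylorPoly p f x y + σ / (Nat.factorial (p + 1) : ℝ) * ‖y - x‖ ^ (p + 1)

/-- `H_max = max {H₀, L_p}`. -/
def Hmax (H0 Lp : ℝ) : ℝ := max H0 Lp

/-- `Ū = ⌈log_{(α+1)/2} (H_max / H₀)⌉`. -/
def Ubar (α H0 Lp : ℝ) : ℤ := ⌈Real.logb ((α + 1) / 2) (Hmax H0 Lp / H0)⌉

/-- Taylor's theorem on the half-line with a Lipschitz-type bound at the origin on the last
derivative; `φ ℓ` plays the role of the `ℓ`-th derivative of `φ 0`. -/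
theorem abs_sub_taylor_sum_le (p : ℕ) (K : ℝ) (φ : ℕ → ℝ → ℝ)
    (hφ : ∀ ℓ < p, ∀ t, HasDerivAt (φ ℓ) (φ (ℓ + 1) t) t)
    (hK : ∀ t, 0 ≤ t → |φ p t - φ p 0| ≤ K * t) (t : ℝ) (ht : 0 ≤ t) :
    |φ 0 t - ∑ ℓ ∈ Finset.range (p + 1), φ ℓ 0 * t ^ ℓ / (Nat.factorial ℓ : ℝ)|
      ≤ K * t ^ (p + 1) / (Nat.factorial (p + 1) : ℝ) := by
  induction p generalizing φ t with
  | zero => simpa using hK t ht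
  | succ p ih =>
    have hderiv : ∀ s : ℝ, HasDerivAt
        (fun s => φ 0 s - ∑ ℓ ∈ Finset.range (p + 2), φ ℓ 0 * s ^ ℓ / (Nat.factorial ℓ : ℝ))
        (φ 1 s - ∑ ℓ ∈ Finset.range (p + 1), φ (ℓ + 1) 0 * s ^ ℓ / (Nat.factorial ℓ : ℝ)) s := by
      intro s
      simp only [Finset.sum_range_succ' _ (p + 1), pow_zero]
      refine (hφ 0 (Nat.succ_pos p) s).sub (HasDerivAt.add_const _ (HasDerivAt.fun_sum ?_))
      intro ℓ _
      refine (((hasDerivAt_pow (ℓ + 1) s).const_mul (φ (ℓ + 1) 0)).div_const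
        (Nat.factorial (ℓ + 1) : ℝ)).congr_deriv ?_
      have : (Nat.factorial ℓ : ℝ) ≠ 0 := by positivity
      rw [Nat.factorial_succ]
      push_cast
      field_simp
    have hbound : ∀ s : ℝ, HasDerivAt
        (fun s => K * s ^ (p + 2) / (Nat.factorial (p + 2) : ℝ))
        (K * s ^ (p + 1) / (Nat.factorial (p + 1) : ℝ)) s := by
      intro s
      refine (((hasDerivAt_pow (p + 2) s).const_mul K).div_const
        (Nat.factorial (p + 2) : ℝ)).congr_deriv ?_
      have : (Nat.factorial (p + 1) : ℝ) ≠ 0 := by positivity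
      rw [Nat.factorial_succ (p + 1)]
      push_cast
      field_simp
      norm_num
      ring
    have key := image_norm_le_of_norm_deriv_right_le_deriv_boundary
      (f := fun s => φ 0 s - ∑ ℓ ∈ Finset.range (p + 2), φ ℓ 0 * s ^ ℓ / (Nat.factorial ℓ : ℝ))
      (a := 0) (b := t)
      (fun s _ => (hderiv s).continuousAt.continuousWithinAt)
      (fun s _ => (hderiv s).hasDerivWithinAt)
      (by simp [Finset.sum_range_succ'])
      (B := fun s => K * s ^ (p + 2) / (Nat.factorial (p + 2) : ℝ)) hbound
      (fun s hs => ih (fun ℓ => φ (ℓ + 1)) (fun ℓ hℓ => hφ (ℓ + 1) (by omega)) hK s hs.1)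
    exact key ⟨ht, le_rfl⟩

/-- The error of the Taylor polynomial of a function with Lipschitz `p`-th derivative. -/
theorem abs_sub_taylorPoly_le {n p : ℕ} {f : EuclideanSpace ℝ (Fin n) → ℝ} {L : ℝ}
    (hf : ContDiff ℝ p f)
    (hLip : ∀ x y : EuclideanSpace ℝ (Fin n),
      ‖iteratedFDeriv ℝ p f x - iteratedFDeriv ℝ p f y‖ ≤ L * ‖x - y‖)
    (x y : EuclideanSpace ℝ (Fin n)) :
    |f y - taylorPoly p f x y| ≤ L / (Nat.factorial (p + 1) : ℝ) * ‖y - x‖ ^ (p + 1) := by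
  have h := abs_sub_taylor_sum_le p (L * ‖y - x‖ ^ (p + 1))
    (fun ℓ t => iteratedFDeriv ℝ ℓ f (x + t • (y - x)) (fun _ => y - x)) ?_ ?_ 1 zero_le_one
  · have hsum : taylorPoly p f x y = ∑ ℓ ∈ Finset.range (p + 1),
        iteratedFDeriv ℝ ℓ f x (fun _ => y - x) / (Nat.factorial ℓ : ℝ) := by
      rw [taylorPoly, Finset.sum_range_succ', ← Finset.Ico_add_one_right_eq_Icc,
        Finset.sum_Ico_eq_sum_range]
      simp only [div_eq_inv_mul, Nat.factorial_zero, Nat.cast_one, inv_one, one_mul,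
        iteratedFDeriv_zero_apply, add_tsub_cancel_right, add_comm (f x)]
      refine congrArg (· + f x) (Finset.sum_congr rfl fun i _ => ?_)
      rw [add_comm 1 i, mul_one]
    rw [hsum]
    simpa [mul_div_right_comm] using h
  · intro ℓ hℓ t
    have hd : HasFDerivAt (iteratedFDeriv ℝ ℓ f)
        (fderiv ℝ (iteratedFDeriv ℝ ℓ f) (x + t • (y - x))) (x + t • (y - x)) :=
      ((hf.differentiable_iteratedFDeriv (by exact_mod_cast hℓ)) _).hasFDerivAt
    have hline : HasDerivAt (fun t : ℝ => x + t • (y - x)) (y - x) t := by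
      simpa using ((hasDerivAt_id t).smul_const (y - x)).const_add x
    have happ := (ContinuousMultilinearMap.apply ℝ (fun _ : Fin ℓ => EuclideanSpace ℝ (Fin n)) ℝ
      (fun _ => y - x)).hasFDerivAt.comp_hasDerivAt t (hd.comp_hasDerivAt t hline)
    exact happ
  · intro t ht
    have h1 := (iteratedFDeriv ℝ p f (x + t • (y - x)) -
      iteratedFDeriv ℝ p f (x + (0 : ℝ) • (y - x))).le_opNorm (fun _ => y - x)
    have h2 := hLip (x + t • (y - x)) (x + (0 : ℝ) • (y - x))
    have h3 : ‖x + t • (y - x) - (x + (0 : ℝ) • (y - x))‖ = t * ‖y - x‖ := by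
      rw [zero_smul, add_zero, add_sub_cancel_left, norm_smul, Real.norm_of_nonneg ht]
    rw [h3] at h2
    simp only [sub_apply, Real.norm_eq_abs, Finset.prod_const,
      Finset.card_univ, Fintype.card_fin] at h1
    refine h1.trans ((mul_le_mul_of_nonneg_right h2 (by positivity)).trans_eq ?_)
    ring

/-- One step of the convergence recursion, with the step size `1 - (s / (s + 1)) ^ (p + 1)`. -/
theorem pow_mul_le_of_convex_step {p s : ℕ} {D δ δ' : ℝ} (hD : 0 ≤ D)
    (hstep : ∀ θ : ℝ, 0 ≤ θ → θ ≤ 1 → δ' ≤ (1 - θ) * δ + D / (p + 1) * θ ^ (p + 1))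
    (hδ : (s : ℝ) ^ (p + 1) * δ ≤ s * (D * ((p : ℝ) + 1) ^ p)) :
    ((s + 1 : ℕ) : ℝ) ^ (p + 1) * δ' ≤ ((s + 1 : ℕ) : ℝ) * (D * ((p : ℝ) + 1) ^ p) := by
  push_cast
  set q : ℝ := s / (s + 1) with hq
  have hs : (0 : ℝ) < s + 1 := by positivity
  have hq0 : 0 ≤ q := by positivity
  have hq1 : q ≤ 1 := by rw [hq, div_le_one hs]; linarith
  have hqs : (s + 1) * q = s := by rw [hq]; field_simp
  have hbern : (s + 1) * (1 - q ^ (p + 1)) ≤ (p : ℝ) + 1 := by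
    have h := one_add_mul_le_pow (a := q - 1) (by linarith) (p + 1)
    push_cast at h
    rw [add_sub_cancel] at h
    have h' : (s + 1) * (1 - q) = 1 := by linarith
    nlinarith
  have hθ0 : 0 ≤ 1 - q ^ (p + 1) := sub_nonneg.2 (pow_le_one₀ hq0 hq1)
  have h := hstep (1 - q ^ (p + 1)) hθ0 (by linarith [pow_nonneg hq0 (p + 1)])
  rw [sub_sub_cancel] at h
  have h1 := mul_le_mul_of_nonneg_left h (pow_nonneg hs.le (p + 1))
  have h2 : ((s + 1) * (1 - q ^ (p + 1))) ^ (p + 1) ≤ ((p : ℝ) + 1) ^ (p + 1) :=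
    pow_le_pow_left₀ (by positivity) hbern _
  have hp : (0 : ℝ) < p + 1 := by positivity
  have h3 : D / (p + 1) * ((s + 1) * (1 - q ^ (p + 1))) ^ (p + 1) ≤ D * ((p : ℝ) + 1) ^ p := by
    refine (mul_le_mul_of_nonneg_left h2 (by positivity)).trans_eq ?_
    rw [pow_succ]
    field_simp
  have h4 : ((s : ℝ) + 1) ^ (p + 1) * (q ^ (p + 1) * δ +
      D / (p + 1) * (1 - q ^ (p + 1)) ^ (p + 1))
      = ((s + 1) * q) ^ (p + 1) * δ +
        D / (p + 1) * ((s + 1) * (1 - q ^ (p + 1))) ^ (p + 1) := by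
    rw [mul_pow, mul_pow]; ring
  rw [h4, hqs] at h1
  linarith

/-- If at every index `k` with `P k` the value `H (k + 1)` exceeds `γ` times `H 0` and `γ` times
the values of `H` at the preceding `B` positive indices, then `c ≥ 1` occurrences of `P` in a window
of length at most `B` force `H` to exceed `γ ^ c * H 0` in that window. -/
theorem exists_pow_mul_lt_of_window {H : ℕ → ℝ} {γ : ℝ} {B : ℕ} {P : ℕ → Prop} [DecidablePred P]
    (hγ : 0 < γ) (h0 : ∀ k, P k → γ * H 0 < H (k + 1))
    (hwin : ∀ k, P k → ∀ i, 1 ≤ i → i ≤ k → k + 1 ≤ i + B → γ * H i < H (k + 1))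
    (j m : ℕ) (hm : m ≤ B) :
    ∃ c, Nat.count P (j + m) = Nat.count P j + c ∧
      (c = 0 ∨ ∃ i, j < i ∧ i ≤ j + m ∧ γ ^ c * H 0 < H i) := by
  induction m with
  | zero => exact ⟨0, by simp⟩
  | succ m ih =>
    obtain ⟨c, hc, hi⟩ := ih (by omega)
    by_cases hP : P (j + m)
    · refine ⟨c + 1, by rw [← add_assoc, Nat.count_succ, if_pos hP, hc, add_assoc],
        Or.inr ⟨j + m + 1, by omega, by omega, ?_⟩⟩
      rcases hi with rfl | ⟨i, hji, hij, hi⟩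
      · simpa using h0 _ hP
      · rw [pow_succ', mul_assoc]
        exact (mul_lt_mul_of_pos_left hi hγ).trans (hwin _ hP i (by omega) hij (by omega))
    · refine ⟨c, by rw [← add_assoc, Nat.count_succ, if_neg hP, hc, add_zero], ?_⟩
      rcases hi with h | ⟨i, hji, hij, hi⟩
      · exact Or.inl h
      · exact Or.inr ⟨i, hji, by omega, hi⟩

/-- A bound on the count in windows of length `B` gives a bound on the total count. -/
theorem count_le_of_window {P : ℕ → Prop} [DecidablePred P] {B : ℕ} {u : ℝ} (hB : 0 < B)
    (h : ∀ j m, m ≤ B → (Nat.count P (j + m) : ℝ) ≤ Nat.count P j + u) (k : ℕ) :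
    (Nat.count P k : ℝ) ≤ u * (k / B + 1) := by
  have hu : 0 ≤ u := by simpa using h 0 0 (Nat.zero_le _)
  induction k using Nat.strong_induction_on with
  | _ k ih =>
    by_cases hk : k ≤ B
    · have h1 := h 0 k hk
      rw [zero_add, Nat.count_zero, Nat.cast_zero, zero_add] at h1
      have : 0 ≤ u * (k / B) := by positivity
      linarith
    · obtain ⟨j, rfl⟩ := Nat.exists_eq_add_of_le (not_le.1 hk).le
      have h1 := h j B le_rfl
      have h2 := ih j (by omega)
      have hB' : (B : ℝ) ≠ 0 := by positivity
      have h3 : ((B + j : ℕ) : ℝ) / B = j / B + 1 := by push_cast; field_simp; ring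
      rw [h3, add_comm B j]
      linarith

theorem HARS_convex_rate
    {n : ℕ} (p : ℕ) (hp : 1 ≤ p)
    (f : EuclideanSpace ℝ (Fin n) → ℝ) (Lp : ℝ)
    (hf : ContDiff ℝ p f)
    (hLip : ∀ x y : EuclideanSpace ℝ (Fin n),
      ‖iteratedFDeriv ℝ p f x - iteratedFDeriv ℝ p f y‖ ≤ Lp * ‖x - y‖)
    (domψ : Set (EuclideanSpace ℝ (Fin n))) (ψ : EuclideanSpace ℝ (Fin n) → ℝ)
    (hdom_ne : domψ.Nonempty) (hdom_closed : IsClosed domψ) (hdom_conv : Convex ℝ domψ)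
    (hψconv : ConvexOn ℝ domψ ψ) (hψlsc : LowerSemicontinuousOn ψ domψ)
    (xstar : EuclideanSpace ℝ (Fin n)) (hstar : xstar ∈ domψ)
    (hminF : ∀ z ∈ domψ, f xstar + ψ xstar ≤ f z + ψ z)
    (α : ℝ) (hα : 1 < α)
    (x d : ℕ → EuclideanSpace ℝ (Fin n)) (H M : ℕ → ℝ)
    (hx0 : x 0 ∈ domψ) (hH0 : 0 < H 0) (hM0 : M 0 = H 0)
    (B : ℕ) (hB : Ubar α (H 0) Lp + 1 ≤ (B : ℤ))
    (hM : ∀ k, 1 ≤ k →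
      M k = (insert (H 0) ((Finset.Icc (max 1 (k - B)) (k - 1)).image H)).max'
        (Finset.insert_nonempty _ _))
    (hdmem : ∀ k, 1 ≤ k → x (k - 1) + d k ∈ domψ)
    (hdmin : ∀ k, 1 ≤ k → ∀ z ∈ domψ,
      omegaReg p (α * M k) f (x (k - 1)) (x (k - 1) + d k) + ψ (x (k - 1) + d k)
        ≤ omegaReg p (α * M k) f (x (k - 1)) z + ψ z)
    (hdne : ∀ k, 1 ≤ k → d k ≠ 0)
    (hxk : ∀ k, 1 ≤ k →
      x k = if f (x (k - 1) + d k) + ψ (x (k - 1) + d k) ≤ f (x (k - 1)) + ψ (x (k - 1))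
            then x (k - 1) + d k else x (k - 1))
    (hHk : ∀ k, 1 ≤ k → H k / (Nat.factorial (p + 1) : ℝ)
      = (f (x (k - 1) + d k) - taylorPoly p f (x (k - 1)) (x (k - 1) + d k)) / ‖d k‖ ^ (p + 1))
    (hfconv : ConvexOn ℝ Set.univ f) (R : ℝ)
    (hR : ∀ z ∈ domψ, f z + ψ z ≤ f (x 0) + ψ (x 0) →
      ∀ w ∈ domψ, f w + ψ w ≤ f (x 0) + ψ (x 0) → ‖z - w‖ ≤ R) :
    ∀ k : ℕ,
      0 < (k : ℝ) * (1 - (Ubar α (H 0) Lp : ℝ) / (B : ℝ)) - (Ubar α (H 0) Lp : ℝ) →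
      f (x k) + ψ (x k) - (f xstar + ψ xstar)
        ≤ (2 * α * Hmax (H 0) Lp * R ^ (p + 1) / (Nat.factorial p : ℝ))
          * (((p : ℝ) + 1)
              / ((k : ℝ) * (1 - (Ubar α (H 0) Lp : ℝ) / (B : ℝ)) - (Ubar α (H 0) Lp : ℝ))) ^ p := by
  classical
  intro k hk
  set Hm := Hmax (H 0) Lp with hHm
  set U : ℝ := (Ubar α (H 0) Lp : ℝ) with hU
  have hHm0 : H 0 ≤ Hm := le_max_left _ _
  have hHmpos : 0 < Hm := hH0.trans_le hHm0
  have hTaylor := abs_sub_taylorPoly_le hf hLip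
  have hHle : ∀ k, 1 ≤ k → H k ≤ Hm := by
    intro k hk
    have h1 := hHk k hk
    have h2 := (abs_le.1 (hTaylor (x (k - 1)) (x (k - 1) + d k))).2
    have hd : 0 < ‖d k‖ ^ (p + 1) := pow_pos (norm_pos_iff.2 (hdne k hk)) _
    rw [add_sub_cancel_left, ← div_le_iff₀ hd, ← h1] at h2
    exact ((div_le_div_iff_of_pos_right (by positivity)).1 h2).trans (le_max_right _ _)
  have hM0le : ∀ k, 1 ≤ k → H 0 ≤ M k := fun k hk => by
    rw [hM k hk]
    exact Finset.le_max' _ _ (Finset.mem_insert_self _ _)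
  have hMge : ∀ k, 1 ≤ k → ∀ i, 1 ≤ i → i < k → k ≤ i + B → H i ≤ M k := by
    intro k hk i hi hik hkB
    rw [hM k hk]
    exact Finset.le_max' _ _ (Finset.mem_insert_of_mem
      (Finset.mem_image_of_mem _ (Finset.mem_Icc.2 (by omega))))
  have hMle : ∀ k, 1 ≤ k → M k ≤ Hm := by
    intro k hk
    rw [hM k hk]
    refine Finset.max'_le _ _ _ fun y hy => ?_
    rcases Finset.mem_insert.1 hy with rfl | hy
    · exact hHm0
    · obtain ⟨i, hi, rfl⟩ := Finset.mem_image.1 hy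
      exact hHle i ((le_max_left _ _).trans (Finset.mem_Icc.1 hi).1)
  have hxdom : ∀ k, x k ∈ domψ := by
    intro k
    induction k with
    | zero => exact hx0
    | succ k ih =>
      rw [hxk (k + 1) (by omega)]
      split_ifs
      · exact hdmem (k + 1) (by omega)
      · simpa using ih
  have hdecr : ∀ k, f (x (k + 1)) + ψ (x (k + 1)) ≤ f (x k) + ψ (x k) := by
    intro k
    rw [hxk (k + 1) (by omega)]
    split_ifs with h
    · simpa using h
    · simp
  have hhalf : ∀ k, f (x (k + 1)) + ψ (x (k + 1))
      ≤ f (x k + d (k + 1)) + ψ (x k + d (k + 1)) := by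
    intro k
    rw [hxk (k + 1) (by omega)]
    split_ifs with h
    · simp
    · simpa using (not_le.1 h).le
  have hsub : ∀ k, f (x k) + ψ (x k) ≤ f (x 0) + ψ (x 0) :=
    fun k => antitone_nat_of_succ_le (f := fun k => f (x k) + ψ (x k)) hdecr (Nat.zero_le k)
  have hRx : ∀ k, ‖xstar - x k‖ ≤ R := fun k =>
    hR xstar hstar (hminF _ hx0) (x k) (hxdom k) (hsub k)
  have hR0 : 0 ≤ R := (norm_nonneg _).trans (hRx 0)
  set P : ℕ → Prop := fun k => (α + 1) * M (k + 1) < 2 * H (k + 1) with hP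
  set D : ℝ := 2 * α * Hm * R ^ (p + 1) / (Nat.factorial p : ℝ) with hD
  have hD0 : 0 ≤ D := by positivity
  have hstep : ∀ k, ¬ P k → ∀ θ : ℝ, 0 ≤ θ → θ ≤ 1 →
      f (x (k + 1)) + ψ (x (k + 1)) - (f xstar + ψ xstar) ≤
        (1 - θ) * (f (x k) + ψ (x k) - (f xstar + ψ xstar)) + D / (p + 1) * θ ^ (p + 1) := by
    intro k hPk θ hθ0 hθ1
    have hk1 : 1 ≤ k + 1 := by omega
    set z := (1 - θ) • x k + θ • xstar with hz
    have hzdom : z ∈ domψ :=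
      hdom_conv (hxdom k) hstar (sub_nonneg.2 hθ1) hθ0 (sub_add_cancel _ _)
    have hzf : f z ≤ (1 - θ) * f (x k) + θ * f xstar :=
      hfconv.2 (Set.mem_univ _) (Set.mem_univ _) (sub_nonneg.2 hθ1) hθ0 (sub_add_cancel _ _)
    have hzψ : ψ z ≤ (1 - θ) * ψ (x k) + θ * ψ xstar :=
      hψconv.2 (hxdom k) hstar (sub_nonneg.2 hθ1) hθ0 (sub_add_cancel _ _)
    have hmin := hdmin (k + 1) hk1 z hzdom
    have hHeq := hHk (k + 1) hk1
    simp only [Nat.add_sub_cancel, omegaReg, add_sub_cancel_left] at hmin hHeq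
    have hdpos : 0 < ‖d (k + 1)‖ ^ (p + 1) := pow_pos (norm_pos_iff.2 (hdne _ hk1)) _
    rw [eq_div_iff hdpos.ne'] at hHeq
    have hfac : (0 : ℝ) < Nat.factorial (p + 1) := by positivity
    have hMpos : 0 < M (k + 1) := hH0.trans_le (hM0le _ hk1)
    have hH : H (k + 1) / (Nat.factorial (p + 1) : ℝ) * ‖d (k + 1)‖ ^ (p + 1) ≤
        α * M (k + 1) / (Nat.factorial (p + 1) : ℝ) * ‖d (k + 1)‖ ^ (p + 1) := by
      have : H (k + 1) ≤ α * M (k + 1) := by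
        have h1 := not_lt.1 hPk
        nlinarith
      gcongr
    have hT := (abs_le.1 (hTaylor (x k) z)).1
    have hznorm : ‖z - x k‖ ^ (p + 1) ≤ θ ^ (p + 1) * R ^ (p + 1) := by
      have : z - x k = θ • (xstar - x k) := by rw [hz]; module
      rw [this, norm_smul, Real.norm_of_nonneg hθ0, mul_pow]
      gcongr
      exact hRx k
    have hcoef : (Lp + α * M (k + 1)) / (Nat.factorial (p + 1) : ℝ) * ‖z - x k‖ ^ (p + 1) ≤
        2 * α * Hm / (Nat.factorial (p + 1) : ℝ) * (θ ^ (p + 1) * R ^ (p + 1)) := by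
      have h1 : Lp ≤ Hm := le_max_right _ _
      have h2 : Lp + α * M (k + 1) ≤ 2 * α * Hm := by
        have := hMle _ hk1
        nlinarith
      gcongr
    have hDeq : 2 * α * Hm / (Nat.factorial (p + 1) : ℝ) * (θ ^ (p + 1) * R ^ (p + 1))
        = D / (p + 1) * θ ^ (p + 1) := by
      rw [hD, Nat.factorial_succ]
      push_cast
      field_simp
    have hsplit : (Lp + α * M (k + 1)) / (Nat.factorial (p + 1) : ℝ) * ‖z - x k‖ ^ (p + 1) =
        Lp / (Nat.factorial (p + 1) : ℝ) * ‖z - x k‖ ^ (p + 1) +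
        α * M (k + 1) / (Nat.factorial (p + 1) : ℝ) * ‖z - x k‖ ^ (p + 1) := by ring
    linarith [hhalf k]
  have hrate : ∀ k, ((Nat.count (fun i => ¬ P i) k : ℕ) : ℝ) ^ (p + 1) *
      (f (x k) + ψ (x k) - (f xstar + ψ xstar)) ≤
      (Nat.count (fun i => ¬ P i) k : ℕ) * (D * ((p : ℝ) + 1) ^ p) := by
    intro k
    induction k with
    | zero => simp
    | succ k ih =>
      by_cases hPk : P k
      · rw [Nat.count_succ, if_neg (not_not.2 hPk), add_zero]
        exact (mul_le_mul_of_nonneg_left (sub_le_sub_right (hdecr k) _) (by positivity)).trans ih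
      · rw [Nat.count_succ, if_pos hPk]
        exact pow_mul_le_of_convex_step hD0 (hstep k hPk) ih
  have hγ : 1 < (α + 1) / 2 := by linarith
  have hU0 : (0 : ℤ) ≤ Ubar α (H 0) Lp :=
    Int.ceil_nonneg (Real.logb_nonneg hγ ((one_le_div hH0).2 hHm0))
  have hBpos : 0 < B := by omega
  have hwin : ∀ j m, m ≤ B → (Nat.count P (j + m) : ℝ) ≤ Nat.count P j + U := by
    intro j m hm
    obtain ⟨c, hc, hi⟩ := exists_pow_mul_lt_of_window (H := H) (γ := (α + 1) / 2) (B := B) (P := P)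
      (by linarith) (fun k hk => by nlinarith [hM0le (k + 1) (by omega), show _ < _ from hk])
      (fun k hk i hi hik hkB => by
        nlinarith [hMge (k + 1) (by omega) i hi (by omega) hkB, show _ < _ from hk]) j m hm
    rw [hc, Nat.cast_add]
    have hcU : (c : ℝ) ≤ U := by
      rcases hi with rfl | ⟨i, hji, -, hi⟩
      · rw [hU, Nat.cast_zero]
        exact_mod_cast hU0
      · have h1 : ((α + 1) / 2) ^ (c : ℝ) < Hm / H 0 := by
          rw [Real.rpow_natCast, lt_div_iff₀ hH0]
          exact hi.trans_le (hHle i (by omega))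
        exact ((Real.lt_logb_iff_rpow_lt hγ (by positivity)).2 h1).le.trans (Int.le_ceil _)
    linarith
  have hcount := count_le_of_window hBpos hwin k
  have hsum : Nat.count P k + Nat.count (fun i => ¬ P i) k = k := by
    simp only [Nat.count_eq_card_filter_range]
    rw [Finset.card_filter_add_card_filter_not, Finset.card_range]
  have hsum' : (Nat.count P k : ℝ) + (Nat.count (fun i => ¬ P i) k : ℕ) = k := by
    exact_mod_cast hsum
  set s : ℝ := ((Nat.count (fun i => ¬ P i) k : ℕ) : ℝ) with hs
  have hKs : (k : ℝ) * (1 - U / B) - U ≤ s := by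
    have : U * ((k : ℝ) / B + 1) = k * (U / B) + U := by ring
    linarith
  have hspos : 0 < s := hk.trans_le hKs
  have hfinal : f (x k) + ψ (x k) - (f xstar + ψ xstar) ≤ D * (((p : ℝ) + 1) / s) ^ p := by
    have h := hrate k
    rw [pow_succ', mul_assoc] at h
    have h' := le_of_mul_le_mul_left h hspos
    rw [div_pow, ← mul_div_assoc, le_div_iff₀ (pow_pos hspos p)]
    linarith
  refine hfinal.trans ?_
  gcongr
end
end

section
/- Consider the HAR-S method with budget B satisfying B ≥ Ū + 1, and let ε_g > 0. If the integer K satisfies K(1 − Ū/B) − Ū ≥ (2(p+1)! (F(x^0) − F(x⋆)) / ((α−1) H_0)) · (2 α H_max / (p! ε_g))^{(p+1)/p}, then there exists an index k ≤ K and a subgradient u of ψ at x^k such that ‖∇f(x^k) + u‖ ≤ ε_g, i.e. dist(0, ∂F(x^k)) ≤ ε_g. If moreover ψ ≡ 0, p ≥ 2, ε_H > 0, and K also satisfies K(1 − Ū/B) − Ū ≥ (2(p+1)! (F(x^0) − F(x⋆)) / ((α−1) H_0)) · (2 α H_max / ((p−1)! ε_H))^{(p+1)/(p−1)}, then the same index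 k additionally satisfies ⟨∇²f(x^k) h, h⟩ ≥ −ε_H ‖h‖² for all h ∈ ℝ^n. Here H_max = max{H_0, L_p} and Ū = ⌈log_{(α+1)/2}(H_max/H_0)⌉. -/
open scoped BigOperators RealInnerProductSpace

noncomputable section

section Taylor
variable {E : Type} [NormedAddCommGroup E] [NormedSpace ℝ E]

/-- Iterated derivatives are symmetric: one distinguished direction may be moved to the last slot. -/
theorem iteratedFDeriv_succ_update_const {F : Type} [NormedAddCommGroup F] [NormedSpace ℝ F]
    {ℓ : ℕ} {g : E → F} (hg : ContDiff ℝ ((ℓ + 1 : ℕ) : WithTop ℕ∞) g) (x v h : E)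
    (i : Fin (ℓ + 1)) :
    iteratedFDeriv ℝ (ℓ + 1) g x (Function.update (fun _ => v) i h)
      = iteratedFDeriv ℝ ℓ (fderiv ℝ g) x (fun _ => v) h := by
  induction ℓ generalizing F with
  | zero =>
    obtain rfl : i = 0 := Fin.fin_one_eq_zero i
    simp [iteratedFDeriv_succ_apply_right]
  | succ m ih =>
    induction i using Fin.lastCases with
    | last =>
      rw [iteratedFDeriv_succ_apply_right]
      simp [Fin.init_def]
    | cast j =>
      have hD : ContDiff ℝ ((m + 1 : ℕ) : WithTop ℕ∞) (fderiv ℝ g) :=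
        hg.fderiv_right (by norm_cast)
      have hlast : Function.update (fun _ : Fin (m + 2) => v) j.castSucc h (Fin.last (m + 1)) = v :=
        Function.update_of_ne (Fin.castSucc_lt_last j).ne' _ _
      let flip : (E →L[ℝ] E →L[ℝ] F) ≃L[ℝ] (E →L[ℝ] E →L[ℝ] F) :=
        (ContinuousLinearMap.flipₗᵢ ℝ E E F).toContinuousLinearEquiv
      have hsymm : flip ∘ fderiv ℝ (fderiv ℝ g) = fderiv ℝ (fderiv ℝ g) := by
        ext z a b
        have hz := (hg.contDiffAt (x := z)).isSymmSndFDerivAt (by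
          simpa using (by norm_cast; omega :
            ((2 : ℕ) : WithTop ℕ∞) ≤ ((m + 1 + 1 : ℕ) : WithTop ℕ∞)))
        exact hz b a
      have hflip := ContinuousLinearEquiv.iteratedFDeriv_comp_left (𝕜 := ℝ)
        (F := E →L[ℝ] E →L[ℝ] F) (G := E →L[ℝ] E →L[ℝ] F) (f := fderiv ℝ (fderiv ℝ g)) (x := x)
        flip (i := m)
      rw [hsymm] at hflip
      rw [iteratedFDeriv_succ_apply_right, hlast, Fin.init_update_castSucc]
      simp only [Fin.init_def]
      rw [ih hD, iteratedFDeriv_succ_apply_right]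
      conv_lhs => rw [hflip]
      rfl

/-- The Taylor polynomial of order `p` of a vector-valued function at `x`, evaluated at `y`. -/
def taylorSum {F : Type} [NormedAddCommGroup F] [NormedSpace ℝ F] (p : ℕ) (g : E → F)
    (x y : E) : F :=
  ∑ ℓ ∈ Finset.range (p + 1),
    (1 / (Nat.factorial ℓ : ℝ)) • iteratedFDeriv ℝ ℓ g x (fun _ => y - x)

theorem taylorSum_self {F : Type} [NormedAddCommGroup F] [NormedSpace ℝ F] (p : ℕ) (g : E → F)
    (x : E) : taylorSum p g x x = g x := by
  rw [taylorSum, Finset.sum_range_succ', Finset.sum_eq_zero]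
  · simp
  · intro ℓ _
    rw [ContinuousMultilinearMap.map_coord_zero _ (0 : Fin (ℓ + 1)) (by simp), smul_zero]

theorem hasFDerivAt_taylorSum {F : Type} [NormedAddCommGroup F] [NormedSpace ℝ F] {p : ℕ}
    {g : E → F} (hg : ContDiff ℝ ((p + 1 : ℕ) : WithTop ℕ∞) g) (x y : E) :
    HasFDerivAt (taylorSum (p + 1) g x) (taylorSum p (fderiv ℝ g) x y) y := by
  have hterm : ∀ ℓ ∈ Finset.range (p + 1),
      HasFDerivAt (fun y => (1 / (Nat.factorial (ℓ + 1) : ℝ)) •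
          iteratedFDeriv ℝ (ℓ + 1) g x (fun _ => y - x))
        ((1 / (Nat.factorial ℓ : ℝ)) • iteratedFDeriv ℝ ℓ (fderiv ℝ g) x (fun _ => y - x)) y := by
    intro ℓ hℓ
    have hg' : ContDiff ℝ ((ℓ + 1 : ℕ) : WithTop ℕ∞) g :=
      hg.of_le (by have := Finset.mem_range.1 hℓ; norm_cast)
    have h1 := (HasFDerivAt.multilinear_comp (iteratedFDeriv ℝ (ℓ + 1) g x)
      (g := fun _ y => y - x) (x := y)
      (fun _ => (hasFDerivAt_id y).sub_const x)).const_smul (1 / (Nat.factorial (ℓ + 1) : ℝ))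
    refine h1.congr_fderiv ?_
    ext h
    simp only [smul_apply, sum_apply, ContinuousLinearMap.comp_apply,
      ContinuousLinearMap.id_apply, ContinuousMultilinearMap.toContinuousLinearMap_apply]
    rw [Finset.sum_congr rfl (fun i _ => iteratedFDeriv_succ_update_const hg' x (y - x) h i)]
    rw [Finset.sum_const, Finset.card_univ, Fintype.card_fin, ← Nat.cast_smul_eq_nsmul ℝ, smul_smul,
      Nat.factorial_succ]
    congr 1
    push_cast
    field_simp
  have := (HasFDerivAt.fun_sum hterm).add_const
    ((1 / (Nat.factorial 0 : ℝ)) • iteratedFDeriv ℝ 0 g x (fun _ => y - x))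
  have heq : taylorSum (p + 1) g x = fun y => ∑ ℓ ∈ Finset.range (p + 1),
      (1 / (Nat.factorial (ℓ + 1) : ℝ)) • iteratedFDeriv ℝ (ℓ + 1) g x (fun _ => y - x)
      + (1 / (Nat.factorial 0 : ℝ)) • iteratedFDeriv ℝ 0 g x (fun _ => y - x) := by
    funext z
    rw [taylorSum, Finset.sum_range_succ']
  rw [heq]
  exact this

/-- A function vanishing at `x` whose derivative grows at most like `C * ‖y - x‖ ^ m` grows at most
like `C / (m + 1) * ‖y - x‖ ^ (m + 1)`. -/
theorem norm_le_of_norm_hasFDerivAt_le_pow {F : Type} [NormedAddCommGroup F] [NormedSpace ℝ F]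
    {R : E → F} {R' : E → E →L[ℝ] F} {x : E} {C : ℝ} {m : ℕ} (hR : ∀ y, HasFDerivAt R (R' y) y)
    (hx : R x = 0) (hb : ∀ y, ‖R' y‖ ≤ C * ‖y - x‖ ^ m) (y : E) :
    ‖R y‖ ≤ C / (m + 1) * ‖y - x‖ ^ (m + 1) := by
  set v := y - x with hv
  have hγ : ∀ t : ℝ, HasDerivAt (fun t : ℝ => x + t • v) v t := fun t => by
    simpa using ((hasDerivAt_id t).smul_const v).const_add x
  have hd : ∀ t : ℝ, HasDerivAt (fun t : ℝ => R (x + t • v)) (R' (x + t • v) v) t :=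
    fun t => (hR _).comp_hasDerivAt t (hγ t)
  have key := image_norm_le_of_norm_deriv_right_le_deriv_boundary (a := 0) (b := 1)
    (f := fun t : ℝ => R (x + t • v)) (f' := fun t => R' (x + t • v) v)
    (B := fun t => C / (m + 1) * ‖v‖ ^ (m + 1) * t ^ (m + 1))
    (B' := fun t => C * ‖v‖ ^ (m + 1) * t ^ m)
    (fun t _ => (hd t).continuousAt.continuousWithinAt)
    (fun t _ => (hd t).hasDerivWithinAt) (by simp [hx])
    (fun t => by
      refine ((hasDerivAt_pow (m + 1) t).const_mul (C / (m + 1) * ‖v‖ ^ (m + 1))).congr_deriv ?_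
      push_cast
      field_simp)
    (fun t ht => by
      refine ((R' (x + t • v)).le_opNorm v).trans ?_
      refine (mul_le_mul_of_nonneg_right (hb _) (norm_nonneg v)).trans (le_of_eq ?_)
      rw [add_sub_cancel_left, norm_smul, Real.norm_of_nonneg ht.1]
      ring)
    (show (1 : ℝ) ∈ Set.Icc (0 : ℝ) 1 by simp)
  simpa [hv] using key

theorem norm_iteratedFDeriv_fderiv_sub {F : Type} [NormedAddCommGroup F] [NormedSpace ℝ F]
    (p : ℕ) (g : E → F) (x y : E) :
    ‖iteratedFDeriv ℝ p (fderiv ℝ g) y - iteratedFDeriv ℝ p (fderiv ℝ g) x‖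
      = ‖iteratedFDeriv ℝ (p + 1) g y - iteratedFDeriv ℝ (p + 1) g x‖ := by
  simp only [iteratedFDeriv_succ_eq_comp_right, Function.comp_apply]
  exact ((continuousMultilinearCurryRightEquiv' ℝ p E F).symm.map_sub _ _ ▸
    (continuousMultilinearCurryRightEquiv' ℝ p E F).symm.norm_map _).symm

theorem norm_sub_taylorSum_le {F : Type} [NormedAddCommGroup F] [NormedSpace ℝ F] {p : ℕ}
    {g : E → F} {L : ℝ} {x : E} (hg : ContDiff ℝ (p : WithTop ℕ∞) g)
    (hL : ∀ y, ‖iteratedFDeriv ℝ p g y - iteratedFDeriv ℝ p g x‖ ≤ L * ‖y - x‖) (y : E) :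
    ‖g y - taylorSum p g x y‖ ≤ L / (Nat.factorial (p + 1) : ℝ) * ‖y - x‖ ^ (p + 1) := by
  induction p generalizing F y with
  | zero =>
    have := hL y
    rw [iteratedFDeriv_zero_eq_comp, Function.comp_apply, Function.comp_apply, ← map_sub,
      LinearIsometryEquiv.norm_map] at this
    simpa [taylorSum] using this
  | succ p ih =>
    have hg1 : Differentiable ℝ g := hg.differentiable (by norm_cast)
    have key := norm_le_of_norm_hasFDerivAt_le_pow (R := fun y => g y - taylorSum (p + 1) g x y)
      (R' := fun y => fderiv ℝ g y - taylorSum p (fderiv ℝ g) x y) (x := x)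
      (fun y => (hg1 y).hasFDerivAt.sub (hasFDerivAt_taylorSum hg x y))
      (by simp [taylorSum_self])
      (ih (hg.fderiv_right (by norm_cast)) fun y => by
        rw [norm_iteratedFDeriv_fderiv_sub]; exact hL y) y
    convert key using 2
    rw [Nat.factorial_succ (p + 1)]
    push_cast
    rw [div_div, mul_comm]

end Taylor

/-- Second-order necessary condition at a local minimum on the line. -/
theorem IsLocalMin.nonneg_of_hasDerivAt_hasDerivAt {φ φ' : ℝ → ℝ} {a c : ℝ}
    (hmin : IsLocalMin φ a) (hφ : ∀ s, HasDerivAt φ (φ' s) s) (hφ' : HasDerivAt φ' c a) :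
    0 ≤ c := by
  by_contra! hc
  have hd : deriv φ = φ' := funext fun s => (hφ s).deriv
  have hmax : IsLocalMax φ a := isLocalMax_of_deriv_deriv_neg (by rwa [hd, hφ'.deriv])
    hmin.deriv_eq_zero (hφ a).continuousAt
  have heq : φ =ᶠ[nhds a] fun _ => φ a := by
    filter_upwards [hmin, hmax] with s h1 h2 using le_antisymm h2 h1
  have h2 := heq.deriv.deriv_eq
  rw [hd, hφ'.deriv] at h2
  simp at h2
  exact hc.ne h2

section Euclid
variable {E : Type} [NormedAddCommGroup E] [InnerProductSpace ℝ E]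

/-- First-order necessary condition for a minimizer of a differentiable plus a convex function. -/
theorem ConvexOn.sub_hasFDerivAt_le_of_isMinOn {s : Set E} {ψ G : E → ℝ} {G' : E →L[ℝ] ℝ} {y z : E}
    (hψ : ConvexOn ℝ s ψ) (hG : HasFDerivAt G G' y) (hy : y ∈ s) (hz : z ∈ s)
    (hmin : ∀ w ∈ s, G y + ψ y ≤ G w + ψ w) : ψ y - G' (z - y) ≤ ψ z := by
  have hγ : HasDerivAt (fun t : ℝ => y + t • (z - y)) (z - y) 0 := by
    simpa using ((hasDerivAt_id (0 : ℝ)).smul_const (z - y)).const_add y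
  have hd : HasDerivAt (fun t : ℝ => G (y + t • (z - y))) (G' (z - y)) 0 :=
    HasFDerivAt.comp_hasDerivAt (0 : ℝ) (by simpa using hG) hγ
  have hlim := (hasDerivAt_iff_tendsto_slope_zero.1 hd).mono_left
    (nhdsWithin_mono (0 : ℝ) (fun t (ht : 0 < t) => ht.ne') :
      nhdsWithin (0 : ℝ) (Set.Ioi 0) ≤ nhdsWithin (0 : ℝ) {0}ᶜ)
  have hle : ψ y - ψ z ≤ G' (z - y) := by
    refine ge_of_tendsto hlim ?_
    filter_upwards [Ioo_mem_nhdsGT (zero_lt_one (α := ℝ))] with t ht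
    have ht1 : 0 ≤ 1 - t := by linarith [ht.2]
    have hw : y + t • (z - y) = (1 - t) • y + t • z := by module
    have h1 := hmin _ (hψ.1 hy hz ht1 ht.1.le (by ring))
    have h2 := hψ.2 hy hz ht1 ht.1.le (by ring)
    rw [← hw] at h1 h2
    simp only [smul_eq_mul, zero_add, zero_smul, add_zero] at h2 ⊢
    rw [← div_eq_inv_mul, le_div_iff₀ ht.1]
    nlinarith
  linarith

theorem hasFDerivAt_norm_sub_pow (q : ℕ) (x y : E) :
    HasFDerivAt (fun y : E => ‖y - x‖ ^ (q + 2))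
      ((((q : ℝ) + 2) * ‖y - x‖ ^ q) • innerSL ℝ (y - x)) y := by
  have h := hasFDerivAt_norm_rpow (y - x) (p := (q : ℝ) + 2)
    (by have := q.cast_nonneg (α := ℝ); linarith)
  have h2 := h.comp y ((hasFDerivAt_id y).sub_const x)
  simp only [ContinuousLinearMap.comp_id, add_sub_cancel_right, Real.rpow_natCast] at h2
  refine h2.congr_of_eventuallyEq (Filter.Eventually.of_forall fun z => ?_)
  simp only [Function.comp_apply, id]
  exact_mod_cast (Real.rpow_natCast ‖z - x‖ (q + 2)).symm

theorem hasDerivAt_norm_pow_mul_inner_line {d : E} (hd : d ≠ 0) (q : ℕ) (h : E) :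
    ∃ c ≤ ((q : ℝ) + 1) * ‖d‖ ^ q * ‖h‖ ^ 2,
      HasDerivAt (fun s : ℝ => ‖d + s • h‖ ^ q * ⟪d + s • h, h⟫) c 0 := by
  have hγ : HasDerivAt (fun s : ℝ => d + s • h) h 0 := by
    simpa using ((hasDerivAt_id (0 : ℝ)).smul_const h).const_add d
  have hN : HasDerivAt (fun s : ℝ => ‖d + s • h‖) (⟪d, h⟫ / ‖d‖) 0 := by
    have := hγ.norm_sq.sqrt (by simpa using hd)
    simp only [Real.sqrt_sq (norm_nonneg _), zero_smul, add_zero] at this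
    refine this.congr_deriv ?_
    field_simp
  have hI : HasDerivAt (fun s : ℝ => ⟪d + s • h, h⟫) (‖h‖ ^ 2) 0 := by
    simpa using hγ.inner ℝ (hasDerivAt_const (0 : ℝ) h)
  refine ⟨_, ?_, (hN.pow q).mul hI⟩
  simp only [zero_smul, add_zero, Pi.pow_apply]
  have hn : 0 < ‖d‖ := norm_pos_iff.2 hd
  rcases q with _ | q
  · simp
  · have hcs : ⟪d, h⟫ * ⟪d, h⟫ ≤ ‖d‖ ^ 2 * ‖h‖ ^ 2 := by
      have := real_inner_mul_inner_self_le d h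
      rwa [real_inner_self_eq_norm_sq, real_inner_self_eq_norm_sq] at this
    have h1 : ‖d‖ ^ q * (⟪d, h⟫ / ‖d‖) * ⟪d, h⟫ ≤ ‖d‖ ^ (q + 1) * ‖h‖ ^ 2 := by
      have : ‖d‖ ^ q * (⟪d, h⟫ / ‖d‖) * ⟪d, h⟫ = ‖d‖ ^ q / ‖d‖ * (⟪d, h⟫ * ⟪d, h⟫) := by ring
      rw [this]
      refine (mul_le_mul_of_nonneg_left hcs (by positivity)).trans (le_of_eq ?_)
      field_simp
      ring
    push_cast
    have := mul_le_mul_of_nonneg_left h1 (by positivity : (0 : ℝ) ≤ (q : ℝ) + 1)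
    linarith
end Euclid

theorem pow_mul_le_one_of_pow_mul_rpow_le_one {N A : ℝ} (hN : 0 ≤ N) (hA : 0 < A) {q r : ℕ}
    (hq : 0 < q) (hr : 0 < r) (h : N ^ r * A ^ ((r : ℝ) / q) ≤ 1) : N ^ q * A ≤ 1 := by
  by_contra! hlt
  have hpos : 0 < (r : ℝ) / q := by positivity
  have h1 := Real.one_lt_rpow hlt hpos
  rw [Real.mul_rpow (by positivity) hA.le, ← Real.rpow_natCast N q, ← Real.rpow_mul hN,
    mul_div_cancel₀ _ (by positivity), Real.rpow_natCast] at h1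
  linarith

/-- If each window of length `B` contains at most `m` marked indices, then the first `K` indices
contain at most `m * (K + B) / B` of them. -/
theorem card_filter_Ioc_mul_le {P : ℕ → Prop} [DecidablePred P] {B m : ℕ} (hB : 0 < B)
    (hw : ∀ a, ((Finset.Ioc a (a + B)).filter P).card ≤ m) (K : ℕ) :
    ((Finset.Ioc 0 K).filter P).card * B ≤ m * (K + B) := by
  induction K using Nat.strong_induction_on with
  | _ K ih =>
    rcases le_or_gt K B with hK | hK
    · have h1 : ((Finset.Ioc 0 K).filter P).card ≤ m :=
        (Finset.card_le_card (Finset.filter_subset_filter _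
          (Finset.Ioc_subset_Ioc_right (by omega)))).trans (hw 0)
      nlinarith
    · obtain ⟨K', rfl⟩ := Nat.exists_eq_add_of_lt hK
      set a := K' + 1 with ha
      have hsub : ((Finset.Ioc 0 (B + K' + 1)).filter P)
          ⊆ ((Finset.Ioc 0 a).filter P) ∪ ((Finset.Ioc a (a + B)).filter P) := by
        intro i hi
        simp only [Finset.mem_filter, Finset.mem_Ioc, Finset.mem_union] at hi ⊢
        by_cases i ≤ a
        · left; grind
        · right; grind
      have h1 := (Finset.card_le_card hsub).trans (Finset.card_union_le _ _)
      have h2 := ih a (by omega)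
      have h3 := hw a
      nlinarith

section Model
variable {E : Type} [NormedAddCommGroup E] [InnerProductSpace ℝ E]

theorem hasFDerivAt_regularized_taylorSum {p : ℕ} {f : E → ℝ}
    (hf : ContDiff ℝ ((p + 1 : ℕ) : WithTop ℕ∞) f) (σ : ℝ) (x y : E) :
    HasFDerivAt (fun y => taylorSum (p + 1) f x y
        + σ / (Nat.factorial (p + 2) : ℝ) * ‖y - x‖ ^ (p + 2))
      (taylorSum p (fderiv ℝ f) x y
        + (σ / (Nat.factorial (p + 1) : ℝ) * ‖y - x‖ ^ p) • innerSL ℝ (y - x)) y := by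
  refine ((hasFDerivAt_taylorSum hf x y).add
    ((hasFDerivAt_norm_sub_pow p x y).const_mul _)).congr_fderiv ?_
  rw [smul_smul, Nat.factorial_succ (p + 1)]
  congr 2
  push_cast
  field_simp
  ring

/-- First-order stationarity measure at a minimizer of the regularized composite model. -/
theorem exists_subgradient_norm_le [CompleteSpace E] {p : ℕ} {f ψ : E → ℝ} {s : Set E} {L σ : ℝ}
    {x y : E} (hf : ContDiff ℝ ((p + 1 : ℕ) : WithTop ℕ∞) f)
    (hL : ∀ y, ‖iteratedFDeriv ℝ (p + 1) f y - iteratedFDeriv ℝ (p + 1) f x‖ ≤ L * ‖y - x‖)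
    (hψ : ConvexOn ℝ s ψ) (hσ : 0 ≤ σ) (hy : y ∈ s)
    (hmin : ∀ z ∈ s, taylorSum (p + 1) f x y + σ / (Nat.factorial (p + 2) : ℝ) * ‖y - x‖ ^ (p + 2)
        + ψ y ≤ taylorSum (p + 1) f x z + σ / (Nat.factorial (p + 2) : ℝ) * ‖z - x‖ ^ (p + 2)
        + ψ z) :
    ∃ u : E, (∀ z ∈ s, ψ y + ⟪u, z - y⟫ ≤ ψ z) ∧
      ‖gradient f y + u‖ ≤ (L + σ) / (Nat.factorial (p + 1) : ℝ) * ‖y - x‖ ^ (p + 1) := by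
  set D := taylorSum p (fderiv ℝ f) x y
        + (σ / (Nat.factorial (p + 1) : ℝ) * ‖y - x‖ ^ p) • innerSL ℝ (y - x) with hD
  refine ⟨-(InnerProductSpace.toDual ℝ E).symm D, fun z hz => ?_, ?_⟩
  · have := hψ.sub_hasFDerivAt_le_of_isMinOn (hasFDerivAt_regularized_taylorSum hf σ x y) hy hz hmin
    rw [inner_neg_left, InnerProductSpace.toDual_symm_apply]
    linarith
  · rw [← sub_eq_add_neg, gradient, ← map_sub, LinearIsometryEquiv.norm_map, hD, ← sub_sub]
    have h1 := norm_sub_taylorSum_le (x := x) (L := L) (hf.fderiv_right (m := p) (by norm_cast))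
      (fun y => by rw [norm_iteratedFDeriv_fderiv_sub]; exact hL y) y
    have h2 : ‖(σ / (Nat.factorial (p + 1) : ℝ) * ‖y - x‖ ^ p) • innerSL ℝ (y - x)‖
        = σ / (Nat.factorial (p + 1) : ℝ) * ‖y - x‖ ^ (p + 1) := by
      rw [norm_smul, innerSL_apply_norm, Real.norm_of_nonneg (by positivity)]
      ring
    refine (norm_sub_le _ _).trans ?_
    rw [h2, add_div, add_mul]
    exact add_le_add_left h1 _

theorem hasDerivAt_fderiv_line {f : E → ℝ} (hf : Differentiable ℝ (fderiv ℝ f)) (y h : E) :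
    HasDerivAt (fun s : ℝ => fderiv ℝ f (y + s • h) h) (fderiv ℝ (fderiv ℝ f) y h h) 0 := by
  have hγ : HasDerivAt (fun s : ℝ => y + s • h) h 0 := by
    simpa using ((hasDerivAt_id (0 : ℝ)).smul_const h).const_add y
  have h1 : HasDerivAt (fun s : ℝ => fderiv ℝ f (y + s • h)) (fderiv ℝ (fderiv ℝ f) y h) 0 :=
    HasFDerivAt.comp_hasDerivAt (0 : ℝ) (by simpa using (hf y).hasFDerivAt) hγ
  simpa using h1.clm_apply (hasDerivAt_const (0 : ℝ) h)

theorem fderiv_fderiv_nonneg_of_forall_le {f : E → ℝ}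
    (hf : ContDiff ℝ ((2 : ℕ) : WithTop ℕ∞) f) {y : E} (hmin : ∀ z, f y ≤ f z) (h : E) :
    0 ≤ fderiv ℝ (fderiv ℝ f) y h h := by
  have hf1 : Differentiable ℝ f := hf.differentiable (by norm_num)
  have hf2 : Differentiable ℝ (fderiv ℝ f) :=
    (hf.fderiv_right (m := 1) (by norm_cast)).differentiable (by norm_num)
  refine IsLocalMin.nonneg_of_hasDerivAt_hasDerivAt (φ := fun s : ℝ => f (y + s • h)) (a := 0)
    (φ' := fun s : ℝ => fderiv ℝ f (y + s • h) h)
    (Filter.Eventually.of_forall fun s => by simpa using hmin _) (fun s => ?_)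
    (hasDerivAt_fderiv_line hf2 y h)
  refine (hf1 _).hasFDerivAt.comp_hasDerivAt s ?_
  simpa using ((hasDerivAt_id s).smul_const h).const_add y

/-- Curvature lower bound at a nonzero-step minimizer of the regularized model. -/
theorem neg_le_fderiv_fderiv_of_forall_le {q : ℕ} {f : E → ℝ} {L σ : ℝ} {x y : E}
    (hf : ContDiff ℝ ((q + 2 : ℕ) : WithTop ℕ∞) f)
    (hL : ∀ y, ‖iteratedFDeriv ℝ (q + 2) f y - iteratedFDeriv ℝ (q + 2) f x‖ ≤ L * ‖y - x‖)
    (hσ : 0 ≤ σ) (hxy : y - x ≠ 0)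
    (hmin : ∀ z, taylorSum (q + 2) f x y + σ / (Nat.factorial (q + 3) : ℝ) * ‖y - x‖ ^ (q + 3)
        ≤ taylorSum (q + 2) f x z + σ / (Nat.factorial (q + 3) : ℝ) * ‖z - x‖ ^ (q + 3)) (h : E) :
    -((L + σ) / (Nat.factorial (q + 1) : ℝ) * ‖y - x‖ ^ (q + 1) * ‖h‖ ^ 2)
      ≤ fderiv ℝ (fderiv ℝ f) y h h := by
  have hf1 : ContDiff ℝ ((q + 1 : ℕ) : WithTop ℕ∞) (fderiv ℝ f) := hf.fderiv_right (by norm_cast)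
  have hf2 : ContDiff ℝ (q : WithTop ℕ∞) (fderiv ℝ (fderiv ℝ f)) := hf1.fderiv_right (by norm_cast)
  obtain ⟨c, hc, hder⟩ := hasDerivAt_norm_pow_mul_inner_line hxy (q + 1) h
  have hγ : ∀ s : ℝ, HasDerivAt (fun s : ℝ => y + s • h) h s := fun s => by
    simpa using ((hasDerivAt_id s).smul_const h).const_add y
  have hT : HasDerivAt (fun s : ℝ => taylorSum (q + 1) (fderiv ℝ f) x (y + s • h) h)
      (taylorSum q (fderiv ℝ (fderiv ℝ f)) x y h h) 0 := by
    have h1 : HasDerivAt (fun s : ℝ => taylorSum (q + 1) (fderiv ℝ f) x (y + s • h))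
        (taylorSum q (fderiv ℝ (fderiv ℝ f)) x y h) 0 := by
      have h0 := hasFDerivAt_taylorSum hf1 x (y + (0 : ℝ) • h)
      have := h0.comp_hasDerivAt (0 : ℝ) (hγ 0)
      rwa [zero_smul, add_zero] at this
    simpa using h1.clm_apply (hasDerivAt_const (0 : ℝ) h)
  have hnn := IsLocalMin.nonneg_of_hasDerivAt_hasDerivAt (a := 0)
    (φ := fun s : ℝ => taylorSum (q + 2) f x (y + s • h)
      + σ / (Nat.factorial (q + 3) : ℝ) * ‖(y + s • h) - x‖ ^ (q + 3))
    (φ' := fun s : ℝ => taylorSum (q + 1) (fderiv ℝ f) x (y + s • h) h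
      + σ / (Nat.factorial (q + 2) : ℝ) * (‖y - x + s • h‖ ^ (q + 1) * ⟪y - x + s • h, h⟫))
    (Filter.Eventually.of_forall fun s => by simpa using hmin (y + s • h))
    (fun s => by
      have := (hasFDerivAt_regularized_taylorSum hf σ x (y + s • h)).comp_hasDerivAt s (hγ s)
      refine this.congr_deriv ?_
      simp only [add_apply, smul_apply, innerSL_apply_apply, smul_eq_mul,
        add_sub_right_comm, mul_assoc])
    (hT.add (hder.const_mul _))
  have hR := norm_sub_taylorSum_le (x := x) (L := L) hf2
    (fun y => by rw [norm_iteratedFDeriv_fderiv_sub, norm_iteratedFDeriv_fderiv_sub]; exact hL y) y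
  have hR2 : |fderiv ℝ (fderiv ℝ f) y h h - taylorSum q (fderiv ℝ (fderiv ℝ f)) x y h h|
      ≤ L / (Nat.factorial (q + 1) : ℝ) * ‖y - x‖ ^ (q + 1) * ‖h‖ ^ 2 := by
    have := (ContinuousLinearMap.le_opNorm₂
      (fderiv ℝ (fderiv ℝ f) y - taylorSum q (fderiv ℝ (fderiv ℝ f)) x y) h h).trans
      (mul_le_mul_of_nonneg_right (mul_le_mul_of_nonneg_right hR (norm_nonneg h)) (norm_nonneg h))
    rw [sq, ← mul_assoc]
    simpa using this
  have hc2 := mul_le_mul_of_nonneg_left hc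
    (by positivity : 0 ≤ σ / (Nat.factorial (q + 2) : ℝ))
  have hfac : σ / (Nat.factorial (q + 2) : ℝ) * ((((q + 1 : ℕ) : ℝ) + 1) * ‖y - x‖ ^ (q + 1) * ‖h‖ ^ 2)
      = σ / (Nat.factorial (q + 1) : ℝ) * ‖y - x‖ ^ (q + 1) * ‖h‖ ^ 2 := by
    rw [Nat.factorial_succ (q + 1)]
    push_cast
    field_simp
  have := (abs_le.1 hR2).1
  rw [add_div, add_mul, add_mul]
  linarith
end Model

/-- Each jump multiplies a lower bound on `H` by `r` as long as the jumps stay within the memory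
window, so a window contains at most `log_r (Hm / H 0)` of them. -/
theorem card_filter_jumps_le {H M : ℕ → ℝ} {B m : ℕ} {r Hm : ℝ} (hr : 1 < r) (hH0 : 0 < H 0)
    (hH : ∀ k, 1 ≤ k → H k ≤ Hm) (hM0 : ∀ k, 1 ≤ k → H 0 ≤ M k)
    (hM : ∀ i k, 1 ≤ i → i < k → k ≤ i + B → H i ≤ M k)
    (hm : Real.logb r (Hm / H 0) ≤ m) [DecidablePred fun k => r * M k < H k] (a : ℕ) :
    ((Finset.Ioc a (a + B)).filter fun k => r * M k < H k).card ≤ m := by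
  have key : ∀ j ≤ B, ((Finset.Ioc a (a + j)).filter fun k => r * M k < H k).card = 0 ∨
      ∃ k ∈ Finset.Ioc a (a + j),
        r ^ ((Finset.Ioc a (a + j)).filter fun k => r * M k < H k).card * H 0 < H k := by
    intro j
    induction j with
    | zero => simp
    | succ j ih =>
      intro hj
      have hins : Finset.Ioc a (a + (j + 1)) = insert (a + (j + 1)) (Finset.Ioc a (a + j)) := by
        ext i; simp only [Finset.mem_Ioc, Finset.mem_insert]; omega
      rw [hins, Finset.filter_insert]
      by_cases hP : r * M (a + (j + 1)) < H (a + (j + 1))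
      · rw [if_pos hP, Finset.card_insert_of_notMem (by simp)]
        refine Or.inr ⟨a + (j + 1), Finset.mem_insert_self _ _, ?_⟩
        set c := ((Finset.Ioc a (a + j)).filter fun k => r * M k < H k).card
        have hle : r ^ c * H 0 ≤ M (a + (j + 1)) := by
          rcases ih (by omega) with h0 | ⟨k, hk, hlt⟩
          · rw [h0, pow_zero, one_mul]; exact hM0 _ (by omega)
          · rw [Finset.mem_Ioc] at hk
            exact hlt.le.trans (hM k _ (by omega) (by omega) (by omega))
        calc r ^ (c + 1) * H 0 = r * (r ^ c * H 0) := by ring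
          _ ≤ r * M (a + (j + 1)) := by gcongr
          _ < _ := hP
      · rw [if_neg hP]
        rcases ih (by omega) with h0 | ⟨k, hk, hlt⟩
        · exact Or.inl h0
        · exact Or.inr ⟨k, Finset.mem_insert_of_mem hk, hlt⟩
  rcases key B le_rfl with h0 | ⟨k, hk, hlt⟩
  · omega
  · have hlt' := hlt.trans_le (hH k (by rw [Finset.mem_Ioc] at hk; omega))
    rw [← lt_div_iff₀ hH0] at hlt'
    have h1 := Real.logb_lt_logb hr (by positivity) hlt'
    rw [Real.logb_pow, Real.logb_self_eq_one hr, mul_one] at h1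
    exact_mod_cast (h1.trans_le hm).le

theorem taylorPoly_eq_taylorSum {n : ℕ} (p : ℕ) (f : EuclideanSpace ℝ (Fin n) → ℝ)
    (x y : EuclideanSpace ℝ (Fin n)) : taylorPoly p f x y = taylorSum p f x y := by
  rw [taylorPoly, taylorSum]
  induction p with
  | zero => simp
  | succ p ih =>
    rw [Finset.sum_Icc_succ_top (by omega), Finset.sum_range_succ, ← ih, add_assoc, smul_eq_mul]

theorem HARS_nonconvex_complexity
    {n : ℕ} (p : ℕ) (hp : 1 ≤ p)
    (f : EuclideanSpace ℝ (Fin n) → ℝ) (Lp : ℝ)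
    (hf : ContDiff ℝ p f)
    (hLip : ∀ x y : EuclideanSpace ℝ (Fin n),
      ‖iteratedFDeriv ℝ p f x - iteratedFDeriv ℝ p f y‖ ≤ Lp * ‖x - y‖)
    (domψ : Set (EuclideanSpace ℝ (Fin n))) (ψ : EuclideanSpace ℝ (Fin n) → ℝ)
    (hdom_ne : domψ.Nonempty) (hdom_closed : IsClosed domψ) (hdom_conv : Convex ℝ domψ)
    (hψconv : ConvexOn ℝ domψ ψ) (hψlsc : LowerSemicontinuousOn ψ domψ)
    (xstar : EuclideanSpace ℝ (Fin n)) (hstar : xstar ∈ domψ)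
    (hminF : ∀ z ∈ domψ, f xstar + ψ xstar ≤ f z + ψ z)
    (α : ℝ) (hα : 1 < α)
    (x d : ℕ → EuclideanSpace ℝ (Fin n)) (H M : ℕ → ℝ)
    (hx0 : x 0 ∈ domψ) (hH0 : 0 < H 0) (hM0 : M 0 = H 0)
    (B : ℕ) (hB : Ubar α (H 0) Lp + 1 ≤ (B : ℤ))
    (hM : ∀ k, 1 ≤ k →
      M k = (insert (H 0) ((Finset.Icc (max 1 (k - B)) (k - 1)).image H)).max'
        (Finset.insert_nonempty _ _))
    (hdmem : ∀ k, 1 ≤ k → x (k - 1) + d k ∈ domψ)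
    (hdmin : ∀ k, 1 ≤ k → ∀ z ∈ domψ,
      omegaReg p (α * M k) f (x (k - 1)) (x (k - 1) + d k) + ψ (x (k - 1) + d k)
        ≤ omegaReg p (α * M k) f (x (k - 1)) z + ψ z)
    (hdne : ∀ k, 1 ≤ k → d k ≠ 0)
    (hxk : ∀ k, 1 ≤ k →
      x k = if f (x (k - 1) + d k) + ψ (x (k - 1) + d k) ≤ f (x (k - 1)) + ψ (x (k - 1))
            then x (k - 1) + d k else x (k - 1))
    (hHk : ∀ k, 1 ≤ k → H k / (Nat.factorial (p + 1) : ℝ)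
      = (f (x (k - 1) + d k) - taylorPoly p f (x (k - 1)) (x (k - 1) + d k)) / ‖d k‖ ^ (p + 1))
    (K : ℕ) (εg εH : ℝ) (hεg : 0 < εg) (hεH : 0 < εH)
    (hK : (2 * (Nat.factorial (p + 1) : ℝ) * ((f (x 0) + ψ (x 0)) - (f xstar + ψ xstar))
          / ((α - 1) * H 0))
        * (2 * α * Hmax (H 0) Lp / ((Nat.factorial p : ℝ) * εg)) ^ (((p : ℝ) + 1) / (p : ℝ))
      ≤ ((K : ℝ) * (1 - (Ubar α (H 0) Lp : ℝ) / (B : ℝ)) - (Ubar α (H 0) Lp : ℝ))) :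
    ∃ k ≤ K,
      (∃ u : EuclideanSpace ℝ (Fin n),
        (∀ z ∈ domψ, ψ (x k) + ⟪u, z - x k⟫ ≤ ψ z) ∧ ‖gradient f (x k) + u‖ ≤ εg) ∧
      ((domψ = Set.univ ∧ (∀ z, ψ z = 0) ∧ 2 ≤ p ∧
          (2 * (Nat.factorial (p + 1) : ℝ) * ((f (x 0) + ψ (x 0)) - (f xstar + ψ xstar))
              / ((α - 1) * H 0))
            * (2 * α * Hmax (H 0) Lp / ((Nat.factorial (p - 1) : ℝ) * εH))
              ^ (((p : ℝ) + 1) / ((p : ℝ) - 1))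
          ≤ ((K : ℝ) * (1 - (Ubar α (H 0) Lp : ℝ) / (B : ℝ)) - (Ubar α (H 0) Lp : ℝ))) →
        ∀ h : EuclideanSpace ℝ (Fin n),
          -(εH * ‖h‖ ^ 2) ≤ iteratedFDeriv ℝ 2 f (x k) (fun _ => h)) := by
  classical
  obtain ⟨q, rfl⟩ : ∃ q, p = q + 1 := ⟨p - 1, by omega⟩
  simp only [omegaReg, taylorPoly_eq_taylorSum] at hdmin hHk
  set Hm := Hmax (H 0) Lp with hHm
  have hHm0 : H 0 ≤ Hm := le_max_left _ _
  have hHmL : Lp ≤ Hm := le_max_right _ _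
  have hHmpos : 0 < Hm := hH0.trans_le hHm0
  have hfac1 : (0 : ℝ) < (Nat.factorial (q + 1) : ℝ) := by positivity
  have hfac2 : (0 : ℝ) < (Nat.factorial (q + 1 + 1) : ℝ) := by positivity
  have hdn : ∀ k, 1 ≤ k → 0 < ‖d k‖ := fun k hk => norm_pos_iff.2 (hdne k hk)
  -- estimates of the local constants
  have hHle : ∀ k, 1 ≤ k → H k ≤ Hm := by
    intro k hk
    have h1 := norm_sub_taylorSum_le (x := x (k - 1)) (L := Lp) hf (fun y => hLip y _)
      (x (k - 1) + d k)
    rw [add_sub_cancel_left] at h1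
    have h2 : H k / (Nat.factorial (q + 1 + 1) : ℝ) ≤ Lp / (Nat.factorial (q + 1 + 1) : ℝ) := by
      rw [hHk k hk, div_le_iff₀ (pow_pos (hdn k hk) _)]
      exact (le_abs_self _).trans h1
    exact ((div_le_div_iff_of_pos_right hfac2).1 h2).trans hHmL
  have hM0le : ∀ k, 1 ≤ k → H 0 ≤ M k := fun k hk => by
    rw [hM k hk]; exact Finset.le_max' _ _ (Finset.mem_insert_self _ _)
  have hMge : ∀ i k, 1 ≤ i → i < k → k ≤ i + B → H i ≤ M k := fun i k hi hik hkB => by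
    rw [hM k (by omega)]
    refine Finset.le_max' _ _ (Finset.mem_insert_of_mem (Finset.mem_image_of_mem _ ?_))
    rw [Finset.mem_Icc]
    omega
  have hMle : ∀ k, 1 ≤ k → M k ≤ Hm := fun k hk => by
    rw [hM k hk]
    refine Finset.max'_le _ _ _ fun y hy => ?_
    rw [Finset.mem_insert, Finset.mem_image] at hy
    rcases hy with rfl | ⟨i, hi, rfl⟩
    · exact hHm0
    · exact hHle i (by rw [Finset.mem_Icc] at hi; omega)
  have hMpos : ∀ k, 1 ≤ k → 0 < M k := fun k hk => hH0.trans_le (hM0le k hk)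
  -- descent
  have hxdom : ∀ k, x k ∈ domψ := by
    intro k
    induction k with
    | zero => exact hx0
    | succ k ih =>
      rw [hxk (k + 1) (by omega)]
      split_ifs
      · exact hdmem _ (by omega)
      · simpa using ih
  set F : ℕ → ℝ := fun k => f (x k) + ψ (x k) with hF
  have hmono : ∀ k, F (k + 1) ≤ F k := by
    intro k
    have h1 := hxk (k + 1) (by omega)
    rw [Nat.add_sub_cancel] at h1
    simp only [hF]
    split_ifs at h1 with h2
    · rwa [h1]
    · rw [h1]
  set c := (α - 1) * H 0 / (2 * (Nat.factorial (q + 1 + 1) : ℝ)) with hc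
  have hcpos : 0 < c := div_pos (mul_pos (by linarith) hH0) (by positivity)
  have hdesc : ∀ k, 1 ≤ k → ¬ ((α + 1) / 2 * M k < H k) →
      x k = x (k - 1) + d k ∧ c * ‖d k‖ ^ (q + 1 + 1) ≤ F (k - 1) - F k := by
    intro k hk hS
    have hmin := hdmin k hk _ (hxdom (k - 1))
    have hpow := pow_pos (hdn k hk) (q + 1 + 1)
    have hH := hHk k hk
    rw [eq_div_iff hpow.ne'] at hH
    rw [taylorSum_self, sub_self, norm_zero, zero_pow (by omega), mul_zero, add_zero,
      add_sub_cancel_left] at hmin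
    have hcoef : c * ‖d k‖ ^ (q + 1 + 1) ≤ α * M k / (Nat.factorial (q + 1 + 1) : ℝ)
        * ‖d k‖ ^ (q + 1 + 1) - H k / (Nat.factorial (q + 1 + 1) : ℝ) * ‖d k‖ ^ (q + 1 + 1) := by
      rw [← sub_mul, ← sub_div]
      refine mul_le_mul_of_nonneg_right ?_ hpow.le
      rw [hc, ← div_div]
      refine div_le_div_of_nonneg_right ?_ hfac2.le
      nlinarith [hM0le k hk]
    have hdec : c * ‖d k‖ ^ (q + 1 + 1) ≤ F (k - 1)
        - (f (x (k - 1) + d k) + ψ (x (k - 1) + d k)) := by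
      simp only [hF]
      linarith
    have hacc : x k = x (k - 1) + d k := by
      rw [hxk k hk, if_pos]
      have := mul_pos hcpos hpow
      simp only [hF] at hdec
      linarith
    refine ⟨hacc, ?_⟩
    simp only [hF] at hdec ⊢
    rwa [hacc]
  -- the initial point is optimal
  set Δ := (f (x 0) + ψ (x 0)) - (f xstar + ψ xstar) with hΔ
  have hΔ0 : 0 ≤ Δ := sub_nonneg.2 (hminF _ hx0)
  rcases hΔ0.eq_or_lt with hΔz | hΔpos
  · have hopt : ∀ z ∈ domψ, f (x 0) + ψ (x 0) ≤ f z + ψ z := fun z hz => by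
      have := hminF z hz
      linarith
    have hf1 : Differentiable ℝ f := hf.differentiable (by norm_cast)
    refine ⟨0, Nat.zero_le _, ⟨-gradient f (x 0), fun z hz => ?_, by simpa using hεg.le⟩, ?_⟩
    · have := hψconv.sub_hasFDerivAt_le_of_isMinOn (hf1 (x 0)).hasFDerivAt hx0 hz hopt
      rw [inner_neg_left, gradient, InnerProductSpace.toDual_symm_apply]
      linarith
    · rintro ⟨hdom, hψ0, hp2, -⟩ h
      rw [iteratedFDeriv_two_apply]
      have h1 := fderiv_fderiv_nonneg_of_forall_le (hf.of_le (by exact_mod_cast hp2))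
        (fun z => by simpa [hψ0] using hopt z (hdom ▸ Set.mem_univ z)) h
      exact (neg_nonpos.2 (by positivity)).trans h1
  -- counting successful steps
  have hlog0 : 0 ≤ Real.logb ((α + 1) / 2) (Hm / H 0) :=
    Real.logb_nonneg (by linarith) ((one_le_div hH0).2 hHm0)
  have hU0 : 0 ≤ Ubar α (H 0) Lp := Int.ceil_nonneg hlog0
  obtain ⟨m, hm⟩ := Int.eq_ofNat_of_zero_le hU0
  have hBpos : 0 < B := by omega
  have hmlog : Real.logb ((α + 1) / 2) (Hm / H 0) ≤ m := by
    have h1 : Real.logb ((α + 1) / 2) (Hm / H 0) ≤ ((Ubar α (H 0) Lp : ℤ) : ℝ) := Int.le_ceil _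
    rw [hm] at h1
    exact_mod_cast h1
  have hcast : ((Ubar α (H 0) Lp : ℤ) : ℝ) = m := by rw [hm]; norm_cast
  rw [hcast] at hK ⊢
  set S := (Finset.Ioc 0 K).filter fun k => ¬ ((α + 1) / 2 * M k < H k) with hS
  have hScard : (K : ℝ) * (1 - m / B) - m ≤ S.card := by
    have h1 := card_filter_Ioc_mul_le hBpos
      (card_filter_jumps_le (B := B) (by linarith) hH0 hHle hM0le hMge hmlog) K
    have h2 := Finset.card_filter_add_card_filter_not (s := Finset.Ioc 0 K)
      (fun k => (α + 1) / 2 * M k < H k)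
    rw [Nat.card_Ioc, Nat.sub_zero] at h2
    set u := ((Finset.Ioc 0 K).filter fun k => (α + 1) / 2 * M k < H k).card
    have hB' : (0 : ℝ) < B := by exact_mod_cast hBpos
    have h1' : (u : ℝ) ≤ m * (K + B) / B := by
      rw [le_div_iff₀ hB']; exact_mod_cast h1
    have h2' : (u : ℝ) + S.card = K := by exact_mod_cast h2
    have h3 : (m : ℝ) * (K + B) / B = K * (m / B) + m := by field_simp
    linarith
  -- a short successful step
  have hsum : ∑ k ∈ S, c * ‖d k‖ ^ (q + 1 + 1) ≤ Δ := by
    calc ∑ k ∈ S, c * ‖d k‖ ^ (q + 1 + 1) ≤ ∑ k ∈ S, (F (k - 1) - F k) := by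
          refine Finset.sum_le_sum fun k hk => ?_
          rw [hS, Finset.mem_filter, Finset.mem_Ioc] at hk
          exact (hdesc k hk.1.1 hk.2).2
      _ ≤ ∑ k ∈ Finset.Ioc 0 K, (F (k - 1) - F k) := by
          refine Finset.sum_le_sum_of_subset_of_nonneg (Finset.filter_subset _ _) fun k hk _ => ?_
          rw [Finset.mem_Ioc] at hk
          have := hmono (k - 1)
          rw [Nat.sub_add_cancel hk.1] at this
          linarith
      _ = F 0 - F K := by
          clear hScard hK hS
          clear S
          induction K with
          | zero => simp
          | succ K ih =>
            rw [← Finset.insert_Ioc_right_eq_Ioc_add_one (Nat.zero_le K),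
              Finset.sum_insert (by simp), ih]
            simp
      _ ≤ Δ := by
          have := hminF _ (hxdom K)
          simp only [hF, hΔ]
          linarith
  set C := 2 * (Nat.factorial (q + 1 + 1) : ℝ) * Δ / ((α - 1) * H 0) with hC
  have hCpos : 0 < C := div_pos (by positivity) (mul_pos (by linarith) hH0)
  have hCc : c * C = Δ := by
    have : α - 1 ≠ 0 := by linarith
    rw [hc, hC]
    field_simp
  have hSpos : (0 : ℝ) < S.card := by
    refine lt_of_lt_of_le ?_ (hK.trans hScard)
    exact mul_pos hCpos (Real.rpow_pos_of_pos (by positivity) _)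
  have hSne : S.Nonempty := Finset.card_pos.1 (by exact_mod_cast hSpos)
  obtain ⟨k, hkS, hk⟩ : ∃ k ∈ S, ‖d k‖ ^ (q + 1 + 1) * S.card ≤ C := by
    obtain ⟨k, hkS, hk⟩ := Finset.exists_le_of_sum_le (f := fun k => c * ‖d k‖ ^ (q + 1 + 1))
      (g := fun _ => Δ / S.card) hSne
      (by rwa [Finset.sum_const, nsmul_eq_mul, mul_div_cancel₀ _ hSpos.ne'])
    refine ⟨k, hkS, ?_⟩
    rw [le_div_iff₀ hSpos, ← hCc, mul_assoc] at hk
    exact le_of_mul_le_mul_left hk hcpos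
  rw [hS, Finset.mem_filter, Finset.mem_Ioc] at hkS
  obtain ⟨⟨hk0, hkK⟩, hkS⟩ := hkS
  have hxd := (hdesc k hk0 hkS).1
  have hshort : ∀ (A : ℝ) (r : ℕ), 0 < A → 0 < r →
      C * A ^ (((q + 1 + 1 : ℕ) : ℝ) / r) ≤ S.card → ‖d k‖ ^ r * A ≤ 1 := by
    intro A r hA hr hle
    refine pow_mul_le_one_of_pow_mul_rpow_le_one (r := q + 1 + 1) (norm_nonneg _) hA hr (by omega) ?_
    have h1 := (mul_le_mul_of_nonneg_left hle (by positivity : 0 ≤ ‖d k‖ ^ (q + 1 + 1))).trans hk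
    refine le_of_mul_le_mul_left ?_ hCpos
    linarith
  have hLM : Lp + α * M k ≤ 2 * α * Hm := by nlinarith [hMle k hk0]
  have hconv : ∀ (ε w N : ℝ), 0 < ε → 0 < w → 0 ≤ N → N * (2 * α * Hm / (w * ε)) ≤ 1 →
      (Lp + α * M k) / w * N ≤ ε := by
    intro ε w N hε hw hN hle
    have h1 : N * (2 * α * Hm) ≤ w * ε := by
      rwa [← mul_div_assoc, div_le_one (by positivity)] at hle
    rw [div_mul_eq_mul_div, div_le_iff₀ hw]
    nlinarith
  have hαM : 0 ≤ α * M k := mul_nonneg (by linarith) (hMpos k hk0).le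
  have hmink := hdmin k hk0
  rw [← hxd] at hmink
  have hdk : x k - x (k - 1) = d k := by rw [hxd, add_sub_cancel_left]
  refine ⟨k, hkK, ?_, ?_⟩
  · obtain ⟨u, hu, hnorm⟩ := exists_subgradient_norm_le hf (fun y => hLip y _) hψconv hαM (hxdom k)
      hmink
    refine ⟨u, hu, hnorm.trans ?_⟩
    rw [hdk]
    refine hconv _ _ _ hεg hfac1 (by positivity) (hshort _ _ (by positivity) (by omega) ?_)
    push_cast at hK ⊢
    exact hK.trans hScard
  · rintro ⟨hdom, hψ0, hp2, hK2⟩ h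
    obtain ⟨t, rfl⟩ : ∃ t, q = t + 1 := ⟨q - 1, by omega⟩
    rw [iteratedFDeriv_two_apply]
    have hcurv := neg_le_fderiv_fderiv_of_forall_le hf (fun y => hLip y _) hαM
      (by rw [hdk]; exact hdne k hk0)
      (fun z => by simpa [hψ0] using hmink z (hdom ▸ Set.mem_univ z)) h
    refine le_trans ?_ hcurv
    rw [hdk, neg_le_neg_iff]
    refine mul_le_mul_of_nonneg_right ?_ (by positivity)
    refine hconv _ _ _ hεH (by positivity) (by positivity)
      (hshort _ _ (by positivity) (by omega) ?_)
    push_cast at hK2 ⊢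
    simp only [add_sub_cancel_right] at hK2
    exact hK2.trans hScard
end
end
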